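/- (Dirac reduction to a hyperplane) Let n ≥ 1 and let V ⊆ ℝ^{n+1} be open with coordinates u⁰,u¹,…,uⁿ; capital indices I,J,K,… run over {0,…,n} and small indices i,j,k,… over {1,…,n}. Let G^{IJ} and C^{IJ}_K be smooth on V, with (G^{IJ}) symmetric and pointwise invertible with inverse (G_{IJ}), with G^{00} > 0 on V, and satisfying for all capital indices: (c1) G^{IJ} = G^{JI}; (c2) ∂_K G^{IJ} = C^{IJ}_K + C^{JI}_K; (c3) C^{IJ}_S G^{SK} + C^{KJ}_S G^{SI} = 0; (c4) C^{IJ}_S G^{SK} + C^{JK}_S G^{SI} + C^{KI}_S G^{SJ} = 0; (c5) G^{KS} ∂_L C^{IJ}_S + C^{KJ}_S ∂_L G^{SI} + C^{KI}_S C^{SJ}_L − C^{IK}_S C^{SJ}_L = 0 (these are the Hamiltonianity conditions for the local third-order operator A = ∂_x(G^{IJ}∂_x + C^{IJ}_K u^K_x)∂_x). Define C_{IJK} := G_{IA} G_{JS} C^{SA}_K and C⁰_{JK} := G_{JI} C^{I0}_K. Let U := {(u¹,…,uⁿ) ∈ ℝⁿ : (0,u¹,…,uⁿ) ∈ V}, and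 define on U: g_{ij}(u) := G_{ij}(0,u), c_{ijk}(u) := C_{ijk}(0,u), and w_{ij}(u) := C⁰_{ij}(0,u)/√(G^{00}(0,u)). Then: (a) the matrix (g_{ij}) is invertible at every point of U, with inverse g^{ij} = (G^{ij} − G^{i0}G^{0j}/G^{00})|_{u⁰=0}; and (b) the triple (g, c, w) satisfies conditions (cond1) on U, where derivatives are taken with respect to u¹,…,uⁿ. In other words, the Dirac reduction of a local third-order Hamiltonian operator to the hyperplane u⁰ = 0 is the nonlocal operator determined by g_{ij} = G_{ij}, c_{ijk} = C_{ijk}, w_{ij} = C⁰_{ij}/√(G^{00}). -/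

import Mathlib

open scoped BigOperators

/-- Partial derivative `∂_k f` in the `k`-th coordinate direction. -/
noncomputable def pd {n : ℕ} (k : Fin n) (f : (Fin n → ℝ) → ℝ) (u : Fin n → ℝ) : ℝ :=
  fderiv ℝ f u (Pi.single k 1)

/-- Conditions (cond1) for a triple `(g, c, w)` on a set `U ⊆ ℝⁿ`:
`g` is the (lower-index) metric `g_{ij}`, `c` are the lowered coefficients `c_{ijk}`,
`w` is the skew-symmetric 2-form `w_{ij}`, and `c^s_{jk} := g^{si} c_{ijk}` is computed
via the pointwise inverse matrix `(g u)⁻¹`. -/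
def Cond1 {n : ℕ} (U : Set (Fin n → ℝ))
    (g : (Fin n → ℝ) → Matrix (Fin n) (Fin n) ℝ)
    (c : (Fin n → ℝ) → Fin n → Fin n → Fin n → ℝ)
    (w : (Fin n → ℝ) → Matrix (Fin n) (Fin n) ℝ) : Prop :=
  ∀ u ∈ U,
    (∀ i j k, pd k (fun x => g x i j) u + c u i j k + c u j i k = 0) ∧
    (∀ i j k, c u i j k + c u i k j = 0) ∧
    (∀ i j k, pd k (fun x => g x i j) u + pd i (fun x => g x j k) u
        + pd j (fun x => g x k i) u = 0) ∧
    (∀ i j, w u i j + w u j i = 0) ∧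
    (∀ i j l, pd l (fun x => w x i j) u
        = ∑ s, (∑ a, (g u)⁻¹ s a * c u a i j) * w u s l) ∧
    (∀ m l p k, pd k (fun x => c x p m l) u
        + ∑ s, (∑ a, (g u)⁻¹ s a * c u a m l) * c u s p k + w u m l * w u p k = 0)

section DiracAlg

variable {ι : Type*} [Fintype ι] [DecidableEq ι]

/-- `Γ^J_{AS} = G_{AI} C^{IJ}_S`. -/
noncomputable def gam (H : Matrix ι ι ℝ) (C : ι → ι → ι → ℝ) (J A S : ι) : ℝ :=
  ∑ I, H A I * C I J S

/-- `C_{NML} = G_{NI} Γ^I_{ML}`. -/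
noncomputable def low (H : Matrix ι ι ℝ) (C : ι → ι → ι → ℝ) (N M L : ι) : ℝ :=
  ∑ I, H N I * gam H C I M L

theorem inv_contract {G H : Matrix ι ι ℝ} (h : G * H = 1) (f : ι → ℝ) (I : ι) :
    ∑ A, G I A * ∑ B, H A B * f B = f I := by
  have : G.mulVec (H.mulVec f) = f := by rw [Matrix.mulVec_mulVec, h, Matrix.one_mulVec]
  exact congrFun this I

theorem raise_gam {G H : Matrix ι ι ℝ} (h : G * H = 1) (C : ι → ι → ι → ℝ) (I J S : ι) :
    ∑ A, G I A * gam H C J A S = C I J S :=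
  inv_contract h (fun I => C I J S) I

theorem raise_low {G H : Matrix ι ι ℝ} (h : G * H = 1) (C : ι → ι → ι → ℝ) (J A S : ι) :
    ∑ T, G J T * low H C T A S = gam H C J A S :=
  inv_contract h (fun I => gam H C I A S) J

theorem contract_inj {G H : Matrix ι ι ℝ} (h : H * G = 1) {f k : ι → ℝ}
    (hf : ∀ I, ∑ A, G I A * f A = ∑ A, G I A * k A) (I : ι) : f I = k I := by
  rw [← inv_contract h f I, ← inv_contract h k I]
  simp only [hf]

theorem inv_symm {G H : Matrix ι ι ℝ} (h : G * H = 1) (h' : H * G = 1)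
    (hs : ∀ I J, G I J = G J I) (I J : ι) : H I J = H J I := by
  have e : G.transpose = G := by ext I J; exact hs J I
  have h2 : H.transpose * G = 1 := by
    have := congrArg Matrix.transpose h
    rwa [Matrix.transpose_mul, e, Matrix.transpose_one] at this
  have : H.transpose = H := by
    calc H.transpose = H.transpose * (G * H) := by rw [h, mul_one]
      _ = H := by rw [← mul_assoc, h2, one_mul]
  exact (congrFun (congrFun this J) I)

theorem expand_C {G H : Matrix ι ι ℝ} (h : G * H = 1) (C : ι → ι → ι → ℝ) (I J K : ι) :
    C I J K = ∑ A, G I A * ∑ B, G J B * low H C B A K := by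
  simp only [raise_low h, raise_gam h]

theorem gam_skew {G H : Matrix ι ι ℝ} (h : G * H = 1) (h' : H * G = 1)
    (hs : ∀ I J, G I J = G J I) {C : ι → ι → ι → ℝ}
    (h3 : ∀ I J K, ∑ S, C I J S * G S K + ∑ S, C K J S * G S I = 0) (J A S : ι) :
    gam H C J A S + gam H C J S A = 0 := by
  have hH := inv_symm h h' hs
  let M : Matrix ι ι ℝ := Matrix.of fun I S => C I J S
  have e1 : M * G + G * M.transpose = 0 := by
    ext I K
    have := h3 I J K
    simp only [Matrix.add_apply, Matrix.mul_apply, Matrix.transpose_apply, Matrix.zero_apply]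
    rw [← this]
    congr 1
    apply Finset.sum_congr rfl
    intro x _
    rw [hs I x, mul_comm]; rfl
  have e2 : H * M + M.transpose * H = 0 := by
    calc H * M + M.transpose * H = H * (M * (G * H)) + (H * G) * M.transpose * H := by
          rw [h, h', mul_one, one_mul]
      _ = H * (M * G + G * M.transpose) * H := by noncomm_ring
      _ = 0 := by rw [e1]; simp
  have := congrFun (congrFun e2 A) S
  simp only [Matrix.add_apply, Matrix.mul_apply, Matrix.transpose_apply, Matrix.zero_apply] at this
  rw [← this]
  unfold gam
  congr 1
  apply Finset.sum_congr rfl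
  intro x _
  rw [hH S x, mul_comm]; rfl

theorem low_skew {G H : Matrix ι ι ℝ} (h : G * H = 1) (h' : H * G = 1)
    (hs : ∀ I J, G I J = G J I) {C : ι → ι → ι → ℝ}
    (h3 : ∀ I J K, ∑ S, C I J S * G S K + ∑ S, C K J S * G S I = 0) (J A S : ι) :
    low H C J A S + low H C J S A = 0 := by
  unfold low
  rw [← Finset.sum_add_distrib]
  apply Finset.sum_eq_zero
  intro I _
  rw [← mul_add, gam_skew h h' hs h3, mul_zero]

theorem contract3 {G H : Matrix ι ι ℝ} (h' : H * G = 1) {X Y : ι → ι → ι → ℝ}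
    (hX : ∀ I J K, ∑ A, G I A * ∑ B, G J B * ∑ E, G K E * X A B E
      = ∑ A, G I A * ∑ B, G J B * ∑ E, G K E * Y A B E) (A B E : ι) : X A B E = Y A B E := by
  refine contract_inj h' (f := fun E => X A B E) (k := fun E => Y A B E) (fun K => ?_) E
  refine contract_inj h' (f := fun B => ∑ E, G K E * X A B E)
    (k := fun B => ∑ E, G K E * Y A B E) (fun J => ?_) B
  refine contract_inj h' (f := fun A => ∑ B, G J B * ∑ E, G K E * X A B E)
    (k := fun A => ∑ B, G J B * ∑ E, G K E * Y A B E) (fun I => ?_) A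
  exact hX I J K

theorem low_cyc {G H : Matrix ι ι ℝ} (h : G * H = 1) (h' : H * G = 1)
    (hs : ∀ I J, G I J = G J I) {C : ι → ι → ι → ℝ}
    (h4 : ∀ I J K, ∑ S, C I J S * G S K + ∑ S, C J K S * G S I
        + ∑ S, C K I S * G S J = 0) (A B E : ι) :
    low H C B A E + low H C E B A + low H C A E B = 0 := by
  refine contract3 h' (X := fun A B E => low H C B A E + low H C E B A + low H C A E B)
    (Y := fun _ _ _ => 0) (fun I J K => ?_) A B E
  have T1 : ∀ I J K, ∑ S, C I J S * G S K
      = ∑ A, ∑ B, ∑ E, G I A * G J B * G K E * low H C B A E := by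
    intro I J K
    simp only [expand_C h C I J, Finset.sum_mul, Finset.mul_sum]
    rw [Finset.sum_comm]
    refine Finset.sum_congr rfl fun A _ => ?_
    rw [Finset.sum_comm]
    refine Finset.sum_congr rfl fun B _ => ?_
    refine Finset.sum_congr rfl fun E _ => ?_
    rw [hs E K]; ring
  have e := h4 I J K
  rw [T1 I J K, T1 J K I, T1 K I J] at e
  have e2 : ∑ A, ∑ B, ∑ E, G J A * G K B * G I E * low H C B A E
      = ∑ A, ∑ B, ∑ E, G I A * G J B * G K E * low H C E B A := by
    have : ∀ A, ∑ B, ∑ E, G J A * G K B * G I E * low H C B A E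
      = ∑ E, ∑ B, G J A * G K B * G I E * low H C B A E := fun A => Finset.sum_comm
    simp only [this]
    rw [Finset.sum_comm]
    refine Finset.sum_congr rfl fun A _ => Finset.sum_congr rfl fun B _ =>
      Finset.sum_congr rfl fun E _ => by ring
  have e3 : ∑ A, ∑ B, ∑ E, G K A * G I B * G J E * low H C B A E
      = ∑ A, ∑ B, ∑ E, G I A * G J B * G K E * low H C A E B := by
    rw [Finset.sum_comm]
    refine Finset.sum_congr rfl fun A _ => ?_
    rw [Finset.sum_comm]
    refine Finset.sum_congr rfl fun B _ =>
      Finset.sum_congr rfl fun E _ => by ring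
  rw [e2, e3] at e
  simp only [mul_zero, Finset.sum_const_zero]
  rw [← e]
  simp only [← Finset.sum_add_distrib, Finset.mul_sum]
  refine Finset.sum_congr rfl fun A _ => Finset.sum_congr rfl fun B _ =>
      Finset.sum_congr rfl fun E _ => by ring

/-- Derivative of the inverse metric. -/
theorem dH_alg {G H : Matrix ι ι ℝ} (h : G * H = 1) (h' : H * G = 1)
    (hs : ∀ I J, G I J = G J I) {C : ι → ι → ι → ℝ} (K : ι) {dH : Matrix ι ι ℝ}
    (hd : ∀ I J, ∑ A, (C I A K + C A I K) * H A J + ∑ A, G I A * dH A J = 0) (I J : ι) :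
    dH I J = - (low H C I J K + low H C J I K) := by
  have hH := inv_symm h h' hs
  refine contract_inj h' (f := fun I => dH I J)
    (k := fun I => -(low H C I J K + low H C J I K)) (fun I => ?_) I
  have e1 : ∑ A, G I A * low H C A J K = ∑ A, C A I K * H A J := by
    rw [raise_low h]
    exact Finset.sum_congr rfl fun A _ => by rw [hH J A, mul_comm]
  have e2 : ∑ A, G I A * low H C J A K = ∑ A, C I A K * H A J := by
    unfold low
    simp only [Finset.mul_sum]
    rw [Finset.sum_comm]
    refine Finset.sum_congr rfl fun B _ => ?_
    rw [← raise_gam h C I B K, Finset.sum_mul]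
    exact Finset.sum_congr rfl fun A _ => by rw [hH J B]; ring
  have := hd I J
  simp only [add_mul, Finset.sum_add_distrib] at this
  simp only [mul_neg, mul_add, Finset.sum_neg_distrib, Finset.sum_add_distrib]
  rw [e1, e2]
  linarith

theorem dgam_alg {G H : Matrix ι ι ℝ} (h : G * H = 1) (h' : H * G = 1)
    (hs : ∀ I J, G I J = G J I) {C : ι → ι → ι → ℝ}
    (h3 : ∀ I J K, ∑ S, C I J S * G S K + ∑ S, C K J S * G S I = 0)
    (h4 : ∀ I J K, ∑ S, C I J S * G S K + ∑ S, C J K S * G S I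
        + ∑ S, C K I S * G S J = 0) (J L : ι)
    {dG dC dg : Matrix ι ι ℝ} (hdG : ∀ I J, dG I J = dG J I)
    (hd : ∀ I S, dC I S = ∑ A, dG I A * gam H C J A S + ∑ A, G I A * dg A S)
    (h5 : ∀ I K, ∑ S, G K S * dC I S + ∑ S, C K J S * dG S I
        + ∑ S, C K I S * C S J L - ∑ S, C I K S * C S J L = 0) (A S : ι) :
    dg A S = ∑ B, gam H C B A S * gam H C J B L := by
  have hN : ∀ A S, ∑ B, gam H C B A S * gam H C J B L = ∑ T, low H C T A S * C T J L := by
    intro A S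
    simp only [← raise_low h C _ A S, ← raise_gam h C _ J L, Finset.sum_mul, Finset.mul_sum]
    rw [Finset.sum_comm]
    refine Finset.sum_congr rfl fun T _ => Finset.sum_congr rfl fun B _ => ?_
    rw [hs B T]; ring
  rw [hN]
  refine contract_inj h' (f := fun S => dg A S)
    (k := fun S => ∑ T, low H C T A S * C T J L) (fun K => ?_) S
  refine contract_inj h' (f := fun A => ∑ S, G K S * dg A S)
    (k := fun A => ∑ S, G K S * ∑ T, low H C T A S * C T J L) (fun I => ?_) A
  have e := h5 I K
  have e1 : ∑ S, G K S * dC I S + ∑ S, C K J S * dG S I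
      = ∑ A, G I A * ∑ S, G K S * dg A S := by
    have a1 : ∑ S, C K J S * dG S I = - ∑ S, G K S * ∑ A, dG I A * gam H C J A S := by
      simp only [← raise_gam h C K J, Finset.sum_mul, Finset.mul_sum]
      rw [Finset.sum_comm, ← Finset.sum_neg_distrib]
      refine Finset.sum_congr rfl fun x _ => ?_
      rw [← Finset.sum_neg_distrib]
      refine Finset.sum_congr rfl fun y _ => ?_
      have := gam_skew h h' hs h3 J x y
      rw [hdG y I, eq_neg_of_add_eq_zero_left this]; ring
    rw [a1]
    simp only [hd, mul_add, Finset.sum_add_distrib, add_neg_cancel_comm]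
    simp only [Finset.mul_sum]
    rw [Finset.sum_comm]
    exact Finset.sum_congr rfl fun x _ => Finset.sum_congr rfl fun y _ => by ring
  have e2 : ∀ T, ∑ A, G I A * ∑ S, G K S * low H C T A S = C I K T - C K I T := by
    intro T
    rw [expand_C h C I K T, expand_C h C K I T]
    simp only [Finset.mul_sum]
    rw [Finset.sum_comm (f := fun A B => G K A * (G I B * low H C B A T)),
      ← Finset.sum_sub_distrib]
    refine Finset.sum_congr rfl fun x _ => ?_
    rw [← Finset.sum_sub_distrib]
    refine Finset.sum_congr rfl fun y _ => ?_
    have a := low_cyc h h' hs h4 x T y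
    have b := low_skew h h' hs h3 y T x
    have : low H C T x y = low H C y x T - low H C x y T := by linarith
    rw [this]; ring
  have e3 : ∑ A, G I A * ∑ S, G K S * ∑ T, low H C T A S * C T J L
      = ∑ T, (C I K T - C K I T) * C T J L := by
    simp only [← e2, Finset.sum_mul, Finset.mul_sum]
    conv_rhs => rw [Finset.sum_comm]
    refine Finset.sum_congr rfl fun x _ => ?_
    conv_rhs => rw [Finset.sum_comm]
    exact Finset.sum_congr rfl fun y _ => Finset.sum_congr rfl fun z _ => by ring
  rw [e3]
  simp only [sub_mul, Finset.sum_sub_distrib]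
  linarith

theorem dlow_alg {H : Matrix ι ι ℝ} {C : ι → ι → ι → ℝ} (K N M L : ι) {dH : Matrix ι ι ℝ}
    {dg : ι → ι → ι → ℝ}
    (hdH : ∀ I J, dH I J = - (low H C I J K + low H C J I K))
    (hdg : ∀ J A S, dg J A S = ∑ B, gam H C B A S * gam H C J B K) :
    ∑ I, (dH N I * gam H C I M L + H N I * dg I M L)
      + ∑ S, gam H C S M L * low H C S N K = 0 := by
  have e : ∑ I, H N I * dg I M L = ∑ B, gam H C B M L * low H C N B K := by
    simp only [hdg]
    unfold low
    simp only [Finset.mul_sum]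
    rw [Finset.sum_comm]
    exact Finset.sum_congr rfl fun x _ => Finset.sum_congr rfl fun y _ => by ring
  rw [Finset.sum_add_distrib, e, ← Finset.sum_add_distrib, ← Finset.sum_add_distrib]
  apply Finset.sum_eq_zero
  intro I _
  rw [hdH]; ring

end DiracAlg

theorem pd_mul {n : ℕ} {k : Fin n} {f h : (Fin n → ℝ) → ℝ} {u : Fin n → ℝ}
    (hf : DifferentiableAt ℝ f u) (hh : DifferentiableAt ℝ h u) :
    pd k (fun x => f x * h x) u = pd k f u * h u + f u * pd k h u := by
  unfold pd
  rw [fderiv_fun_mul hf hh]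
  simp
  ring

theorem pd_sum {n : ℕ} {ι : Type*} [Fintype ι] {k : Fin n} {f : ι → (Fin n → ℝ) → ℝ}
    {u : Fin n → ℝ} (hf : ∀ i, DifferentiableAt ℝ (f i) u) :
    pd k (fun x => ∑ i, f i x) u = ∑ i, pd k (f i) u := by
  unfold pd
  rw [fderiv_fun_sum (fun i _ => hf i)]
  simp

theorem pd_sum_mul {n : ℕ} {ι : Type*} [Fintype ι] {k : Fin n} {f h : ι → (Fin n → ℝ) → ℝ}
    {u : Fin n → ℝ} (hf : ∀ i, DifferentiableAt ℝ (f i) u)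
    (hh : ∀ i, DifferentiableAt ℝ (h i) u) :
    pd k (fun x => ∑ i, f i x * h i x) u
      = ∑ i, (pd k (f i) u * h i u + f i u * pd k (h i) u) := by
  rw [pd_sum (f := fun i x => f i x * h i x) (fun i => (hf i).fun_mul (hh i))]
  exact Finset.sum_congr rfl fun i _ => pd_mul (hf i) (hh i)

theorem pd_congr {n : ℕ} {k : Fin n} {V : Set (Fin n → ℝ)} (hV : IsOpen V)
    {f h : (Fin n → ℝ) → ℝ} {u : Fin n → ℝ} (hu : u ∈ V) (e : ∀ x ∈ V, f x = h x) :
    pd k f u = pd k h u := by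
  unfold pd
  rw [Filter.EventuallyEq.fderiv_eq (Filter.eventuallyEq_of_mem (hV.mem_nhds hu) e)]

theorem pd_const {n : ℕ} {k : Fin n} (r : ℝ) (u : Fin n → ℝ) : pd k (fun _ => r) u = 0 := by
  simp [pd]

theorem pd_cons {n : ℕ} {k : Fin n} {f : (Fin (n + 1) → ℝ) → ℝ} {u : Fin n → ℝ}
    (hf : DifferentiableAt ℝ f (Fin.cons 0 u : Fin (n + 1) → ℝ)) :
    pd k (fun x => f (Fin.cons 0 x)) u = pd k.succ f (Fin.cons 0 u) := by
  let Λ : (Fin n → ℝ) →L[ℝ] (Fin (n + 1) → ℝ) :=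
    ContinuousLinearMap.pi (Fin.cons 0 (fun i => ContinuousLinearMap.proj i))
  have hΛ : ∀ x : Fin n → ℝ, Λ x = (Fin.cons 0 x : Fin (n + 1) → ℝ) := by
    intro x
    funext i
    refine Fin.cases ?_ (fun i => ?_) i <;> simp [Λ]
  have e : (fun x : Fin n → ℝ => f (Fin.cons 0 x)) = f ∘ Λ := by
    funext x; simp [hΛ]
  unfold pd
  rw [e, fderiv_comp u (by rw [hΛ]; exact hf) Λ.differentiableAt]
  rw [hΛ]
  simp only [ContinuousLinearMap.fderiv, ContinuousLinearMap.comp_apply]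
  congr 1
  rw [hΛ]
  funext i
  refine Fin.cases ?_ (fun i => ?_) i
  · simp
  · simp [Pi.single_apply]

theorem det_diff {m : ℕ} {E : Type*} [NormedAddCommGroup E] [NormedSpace ℝ E]
    {M : E → Matrix (Fin m) (Fin m) ℝ} {v : E}
    (hM : ∀ i j, DifferentiableAt ℝ (fun x => M x i j) v) :
    DifferentiableAt ℝ (fun x => (M x).det) v := by
  simp only [Matrix.det_apply']
  fun_prop

theorem inv_diff {m : ℕ} {V : Set (Fin m → ℝ)} (hV : IsOpen V)
    {G H : (Fin m → ℝ) → Matrix (Fin m) (Fin m) ℝ}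
    (hGH : ∀ v ∈ V, G v * H v = 1) {v : Fin m → ℝ} (hv : v ∈ V)
    (hG : ∀ i j, DifferentiableAt ℝ (fun x => G x i j) v) (i j : Fin m) :
    DifferentiableAt ℝ (fun x => H x i j) v := by
  have hdet : ∀ v ∈ V, (G v).det ≠ 0 := by
    intro v hv h0
    have := congrArg Matrix.det (hGH v hv)
    rw [Matrix.det_mul, h0, zero_mul, Matrix.det_one] at this
    exact zero_ne_one this
  have e : ∀ x ∈ V, H x i j = (G x).det⁻¹ * (G x).adjugate i j := by
    intro x hx
    have : H x = (G x)⁻¹ := (Matrix.inv_eq_right_inv (hGH x hx)).symm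
    rw [this, Matrix.inv_def]
    simp
  have hd : DifferentiableAt ℝ (fun x => (G x).det⁻¹ * (G x).adjugate i j) v := by
    refine ((det_diff hG).inv (hdet v hv)).mul ?_
    simp only [Matrix.adjugate_apply]
    apply det_diff
    intro a b
    simp only [Matrix.updateRow_apply]
    split_ifs
    · exact differentiableAt_const _
    · exact hG a b
  exact hd.congr_of_eventuallyEq (Filter.eventuallyEq_of_mem (hV.mem_nhds hv) e)

/-- The reduced inverse metric, contracted. -/
theorem reduced_contract {n : ℕ} (G : Matrix (Fin (n + 1)) (Fin (n + 1)) ℝ) (h0 : G 0 0 ≠ 0)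
    (X Y : Fin (n + 1) → ℝ) :
    ∑ s : Fin n, (∑ a : Fin n, (G s.succ a.succ - G s.succ 0 * G 0 a.succ / G 0 0) * X a.succ)
        * Y s.succ
      = ∑ S, (∑ A, G S A * X A) * Y S - (∑ S, G S 0 * Y S) * (∑ A, G 0 A * X A) / G 0 0 := by
  have e1 : ∀ S, ∑ A, (G S A - G S 0 * G 0 A / G 0 0) * X A
      = ∑ A, G S A * X A - G S 0 * (∑ A, G 0 A * X A) / G 0 0 := by
    intro S
    rw [Finset.mul_sum, Finset.sum_div, ← Finset.sum_sub_distrib]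
    exact Finset.sum_congr rfl fun A _ => by ring
  have e2 : ∀ S, ∑ a : Fin n, (G S a.succ - G S 0 * G 0 a.succ / G 0 0) * X a.succ
      = ∑ A, (G S A - G S 0 * G 0 A / G 0 0) * X A := by
    intro S
    rw [Fin.sum_univ_succ (f := fun A => (G S A - G S 0 * G 0 A / G 0 0) * X A)]
    rw [mul_div_assoc (G S 0) (G 0 0), div_self h0]; simp
  have e3 : ∑ S : Fin (n + 1), (∑ A, (G S A - G S 0 * G 0 A / G 0 0) * X A) * Y S
      = ∑ s : Fin n, (∑ A, (G s.succ A - G s.succ 0 * G 0 A / G 0 0) * X A) * Y s.succ := by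
    rw [Fin.sum_univ_succ]
    have : ∀ A, (G 0 A - G 0 0 * G 0 A / G 0 0) * X A = 0 := by
      intro A; rw [mul_comm (G 0 0), mul_div_assoc, div_self h0]; simp
    simp [this]
  simp only [e2]
  rw [← e3]
  simp only [e1]
  simp only [sub_mul, Finset.sum_sub_distrib]
  congr 1
  rw [Finset.sum_mul, Finset.sum_div]
  exact Finset.sum_congr rfl fun A _ => by ring

theorem reduced_inv {n : ℕ} {G H : Matrix (Fin (n + 1)) (Fin (n + 1)) ℝ} (h : G * H = 1)
    (h0 : G 0 0 ≠ 0) :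
    (Matrix.of fun i j : Fin n => G i.succ j.succ - G i.succ 0 * G 0 j.succ / G 0 0)
      * (Matrix.of fun i j : Fin n => H i.succ j.succ) = 1 := by
  ext i j
  have e : ∀ I J, ∑ A, G I A * H A J = (1 : Matrix _ _ ℝ) I J := by
    intro I J; rw [← h, Matrix.mul_apply]
  have a := e i.succ j.succ
  have b := e 0 j.succ
  rw [Fin.sum_univ_succ] at a b
  rw [Matrix.one_apply_ne (Fin.succ_ne_zero j).symm] at b
  have c : (1 : Matrix (Fin (n + 1)) (Fin (n + 1)) ℝ) i.succ j.succ
      = (1 : Matrix (Fin n) (Fin n) ℝ) i j := by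
    simp [Matrix.one_apply]
  rw [c] at a
  simp only [Matrix.mul_apply, Matrix.of_apply, sub_mul, Finset.sum_sub_distrib]
  have d : ∑ x : Fin n, G i.succ 0 * G 0 x.succ / G 0 0 * H x.succ j.succ
      = G i.succ 0 / G 0 0 * ∑ x : Fin n, G 0 x.succ * H x.succ j.succ := by
    rw [Finset.mul_sum]
    exact Finset.sum_congr rfl fun A _ => by ring
  rw [d, ← a, eq_neg_of_add_eq_zero_right b]
  field_simp
  ring

/-- Dirac reduction of a local third-order Hamiltonian operator (with data
`G^{IJ}`, `C^{IJ}_K` on an open `V ⊆ ℝ^{n+1}`, satisfying the local Hamiltonianity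
conditions and `G⁰⁰ > 0`) to the hyperplane `u⁰ = 0` gives the nonlocal operator
determined by `g_{ij} = G_{ij}`, `c_{ijk} = C_{ijk}`, `w_{ij} = C⁰_{ij}/√(G⁰⁰)`:
the matrix `(g_{ij})` is pointwise invertible with inverse
`g^{ij} = G^{ij} − G^{i0}G^{0j}/G^{00}`, and `(g,c,w)` satisfies (cond1) on
`U = {u : (0,u) ∈ V}`. Capital indices run in `Fin (n+1)`, small indices in `Fin n`
(embedded via `Fin.succ`), and the hyperplane embedding is `u ↦ Fin.cons 0 u`. -/
theorem dirac_reduction {n : ℕ} (hn : 1 ≤ n)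
    (V : Set (Fin (n + 1) → ℝ)) (hV : IsOpen V)
    (G : (Fin (n + 1) → ℝ) → Matrix (Fin (n + 1)) (Fin (n + 1)) ℝ)
    (Glow : (Fin (n + 1) → ℝ) → Matrix (Fin (n + 1)) (Fin (n + 1)) ℝ)
    (C : (Fin (n + 1) → ℝ) → Fin (n + 1) → Fin (n + 1) → Fin (n + 1) → ℝ)
    (hGsm : ∀ I J, ContDiffOn ℝ (⊤ : ℕ∞) (fun v => G v I J) V)
    (hCsm : ∀ I J K, ContDiffOn ℝ (⊤ : ℕ∞) (fun v => C v I J K) V)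
    (hGL : ∀ v ∈ V, G v * Glow v = 1 ∧ Glow v * G v = 1)
    (hG00 : ∀ v ∈ V, 0 < G v 0 0)
    (hc1 : ∀ v ∈ V, ∀ I J, G v I J = G v J I)
    (hc2 : ∀ v ∈ V, ∀ I J K, pd K (fun x => G x I J) v = C v I J K + C v J I K)
    (hc3 : ∀ v ∈ V, ∀ I J K,
      ∑ S, C v I J S * G v S K + ∑ S, C v K J S * G v S I = 0)
    (hc4 : ∀ v ∈ V, ∀ I J K,
      ∑ S, C v I J S * G v S K + ∑ S, C v J K S * G v S I
        + ∑ S, C v K I S * G v S J = 0)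
    (hc5 : ∀ v ∈ V, ∀ I J K L,
      ∑ S, G v K S * pd L (fun x => C x I J S) v
        + ∑ S, C v K J S * pd L (fun x => G x S I) v
        + ∑ S, C v K I S * C v S J L - ∑ S, C v I K S * C v S J L = 0)
    (U : Set (Fin n → ℝ)) (hU : U = {u | Fin.cons 0 u ∈ V})
    (g : (Fin n → ℝ) → Matrix (Fin n) (Fin n) ℝ)
    (hg : g = fun u => Matrix.of fun i j => Glow (Fin.cons 0 u) i.succ j.succ)
    (c : (Fin n → ℝ) → Fin n → Fin n → Fin n → ℝ)
    (hc : c = fun u i j k => ∑ A, ∑ S,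
      Glow (Fin.cons 0 u) i.succ A * Glow (Fin.cons 0 u) j.succ S
        * C (Fin.cons 0 u) S A k.succ)
    (w : (Fin n → ℝ) → Matrix (Fin n) (Fin n) ℝ)
    (hw : w = fun u => Matrix.of fun i j =>
      (∑ I, Glow (Fin.cons 0 u) i.succ I * C (Fin.cons 0 u) I 0 j.succ)
        / Real.sqrt (G (Fin.cons 0 u) 0 0))
    (gi : (Fin n → ℝ) → Matrix (Fin n) (Fin n) ℝ)
    (hgi : gi = fun u => Matrix.of fun i j =>
      G (Fin.cons 0 u) i.succ j.succ
        - G (Fin.cons 0 u) i.succ 0 * G (Fin.cons 0 u) 0 j.succ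
            / G (Fin.cons 0 u) 0 0) :
    (∀ u ∈ U, g u * gi u = 1 ∧ gi u * g u = 1) ∧ Cond1 U g c w := by
  have hGd : ∀ v ∈ V, ∀ I J, DifferentiableAt ℝ (fun x => G x I J) v := fun v hv I J =>
    ((hGsm I J).differentiableOn (by simp)).differentiableAt (hV.mem_nhds hv)
  have hCd : ∀ v ∈ V, ∀ I J K, DifferentiableAt ℝ (fun x => C x I J K) v := fun v hv I J K =>
    ((hCsm I J K).differentiableOn (by simp)).differentiableAt (hV.mem_nhds hv)
  have hHd : ∀ v ∈ V, ∀ I J, DifferentiableAt ℝ (fun x => Glow x I J) v := fun v hv I J =>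
    inv_diff hV (fun v hv => (hGL v hv).1) hv (hGd v hv) I J
  have hgamd : ∀ v ∈ V, ∀ I J K,
      DifferentiableAt ℝ (fun x => gam (Glow x) (C x) I J K) v := by
    intro v hv I J K
    unfold gam
    exact DifferentiableAt.fun_sum fun A _ => (hHd v hv _ _).mul (hCd v hv _ _ _)
  have hlowd : ∀ v ∈ V, ∀ I J K,
      DifferentiableAt ℝ (fun x => low (Glow x) (C x) I J K) v := by
    intro v hv I J K
    unfold low
    exact DifferentiableAt.fun_sum fun A _ => (hHd v hv _ _).mul (hgamd v hv _ _ _)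
  have hdH : ∀ v ∈ V, ∀ K I J, pd K (fun x => Glow x I J) v
      = - (low (Glow v) (C v) I J K + low (Glow v) (C v) J I K) := by
    intro v hv K I J
    refine dH_alg (hGL v hv).1 (hGL v hv).2 (hc1 v hv) K
      (dH := fun I J => pd K (fun x => Glow x I J) v) (fun I J => ?_) I J
    have e : pd K (fun x => ∑ A, G x I A * Glow x A J) v = 0 := by
      rw [pd_congr hV hv (h := fun _ => (1 : Matrix _ _ ℝ) I J), pd_const]
      intro x hx
      rw [← (hGL x hx).1, Matrix.mul_apply]
    rw [pd_sum_mul (fun A => hGd v hv I A) (fun A => hHd v hv A J),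
      Finset.sum_add_distrib] at e
    simpa only [hc2 v hv] using e
  have hdgam : ∀ v ∈ V, ∀ L J A S, pd L (fun x => gam (Glow x) (C x) J A S) v
      = ∑ B, gam (Glow v) (C v) B A S * gam (Glow v) (C v) J B L := by
    intro v hv L J A S
    refine dgam_alg (hGL v hv).1 (hGL v hv).2 (hc1 v hv) (hc3 v hv) (hc4 v hv) J L
      (dG := fun I J => pd L (fun x => G x I J) v)
      (dC := fun I S => pd L (fun x => C x I J S) v)
      (dg := fun A S => pd L (fun x => gam (Glow x) (C x) J A S) v)
      (fun I J => pd_congr hV hv fun x hx => hc1 x hx I J) (fun I S => ?_)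
      (fun I K => hc5 v hv I J K L) A S
    rw [← Finset.sum_add_distrib, ← pd_sum_mul (fun A => hGd v hv I A)
      (fun A => hgamd v hv J A S)]
    exact pd_congr hV hv fun x hx => (raise_gam (hGL x hx).1 _ _ _ _).symm
  have hdlow : ∀ v ∈ V, ∀ K N M L, pd K (fun x => low (Glow x) (C x) N M L) v
      + ∑ S, gam (Glow v) (C v) S M L * low (Glow v) (C v) S N K = 0 := by
    intro v hv K N M L
    have := dlow_alg K N M L (hdH v hv K) (hdgam v hv K)
    rw [← this]
    congr 1
    unfold low
    exact pd_sum_mul (fun A => hHd v hv N A) (fun A => hgamd v hv A M L)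
  have hc' : c = fun u i j k => low (Glow (Fin.cons 0 u)) (C (Fin.cons 0 u))
      i.succ j.succ k.succ := by
    rw [hc]
    funext u i j k
    unfold low gam
    simp only [Finset.mul_sum, mul_assoc]
  have hw' : w = fun u => Matrix.of fun i j =>
      gam (Glow (Fin.cons 0 u)) (C (Fin.cons 0 u)) 0 i.succ j.succ
        / Real.sqrt (G (Fin.cons 0 u) 0 0) := hw
  have hinv : ∀ u ∈ U, gi u * g u = 1 := by
    intro u hu
    rw [hU] at hu
    rw [hgi, hg]
    exact reduced_inv (hGL _ hu).1 (hG00 _ hu).ne'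
  refine ⟨fun u hu => ⟨mul_eq_one_comm.mp (hinv u hu), hinv u hu⟩, ?_⟩
  intro u hu
  have hginv : (g u)⁻¹ = gi u := Matrix.inv_eq_left_inv (hinv u hu)
  rw [hU] at hu
  have hv : (Fin.cons 0 u : Fin (n + 1) → ℝ) ∈ V := hu
  have hdg : ∀ i j k, pd k (fun x => g x i j) u
      = - (low (Glow (Fin.cons 0 u)) (C (Fin.cons 0 u)) i.succ j.succ k.succ
        + low (Glow (Fin.cons 0 u)) (C (Fin.cons 0 u)) j.succ i.succ k.succ) := by
    intro i j k
    rw [hg, ← hdH _ hv]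
    exact pd_cons (hHd _ hv i.succ j.succ)
  have hls := low_skew (hGL _ hv).1 (hGL _ hv).2 (hc1 _ hv) (hc3 _ hv)
  have hgs := gam_skew (hGL _ hv).1 (hGL _ hv).2 (hc1 _ hv) (hc3 _ hv)
  have h00 := hG00 _ hv
  have hcontr : ∀ (i j : Fin n) (Y : Fin (n + 1) → ℝ),
      ∑ s : Fin n, (∑ a, (g u)⁻¹ s a * c u a i j) * Y s.succ
      = ∑ S, gam (Glow (Fin.cons 0 u)) (C (Fin.cons 0 u)) S i.succ j.succ * Y S
        - (∑ S, G (Fin.cons 0 u) S 0 * Y S)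
          * gam (Glow (Fin.cons 0 u)) (C (Fin.cons 0 u)) 0 i.succ j.succ
          / G (Fin.cons 0 u) 0 0 := by
    intro i j Y
    have := reduced_contract (G (Fin.cons 0 u)) h00.ne'
      (fun A => low (Glow (Fin.cons 0 u)) (C (Fin.cons 0 u)) A i.succ j.succ) Y
    simp only [raise_low (hGL _ hv).1] at this
    rw [← this, hginv, hgi, hc']
    rfl
  set v : Fin (n + 1) → ℝ := Fin.cons 0 u with hvdef
  have hr : 0 < Real.sqrt (G v 0 0) := Real.sqrt_pos.mpr h00
  have hrr : Real.sqrt (G v 0 0) * Real.sqrt (G v 0 0) = G v 0 0 := Real.mul_self_sqrt h00.le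
  refine ⟨?_, ?_, ?_, ?_, ?_, ?_⟩
  · intro i j k
    rw [hdg, hc']; simp only [← hvdef]; ring
  · intro i j k
    rw [hc']; exact hls _ _ _
  · intro i j k
    rw [hdg, hdg, hdg]
    have a := hls i.succ j.succ k.succ
    have b := hls j.succ i.succ k.succ
    have d := hls k.succ i.succ j.succ
    linarith
  · intro i j
    rw [hw']
    simp only [Matrix.of_apply, ← hvdef]
    rw [← add_div, hgs, zero_div]
  · intro i j l
    have hrd : DifferentiableAt ℝ (fun x => Real.sqrt (G x 0 0)) v :=
      (hGd v hv 0 0).sqrt h00.ne'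
    have hwd : DifferentiableAt ℝ (fun x => gam (Glow x) (C x) 0 i.succ j.succ
        / Real.sqrt (G x 0 0)) v := by
      simp only [div_eq_mul_inv]
      exact (hgamd v hv 0 i.succ j.succ).fun_mul (hrd.fun_inv hr.ne')
    have e1 : pd l (fun x => w x i j) u = pd l.succ (fun x =>
        gam (Glow x) (C x) 0 i.succ j.succ / Real.sqrt (G x 0 0)) v := by
      rw [hw']; exact pd_cons hwd
    have e2 : pd l.succ (fun x => G x 0 0) v
        = 2 * Real.sqrt (G v 0 0) * pd l.succ (fun x => Real.sqrt (G x 0 0)) v := by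
      rw [pd_congr hV hv (h := fun x => Real.sqrt (G x 0 0) * Real.sqrt (G x 0 0))
        (fun x hx => (Real.mul_self_sqrt (hG00 x hx).le).symm), pd_mul hrd hrd]
      ring
    have e3 : pd l.succ (fun x => gam (Glow x) (C x) 0 i.succ j.succ) v
        = pd l (fun x => w x i j) u * Real.sqrt (G v 0 0)
          + gam (Glow v) (C v) 0 i.succ j.succ / Real.sqrt (G v 0 0)
            * pd l.succ (fun x => Real.sqrt (G x 0 0)) v := by
      rw [e1, ← pd_mul hwd hrd]
      refine pd_congr hV hv fun x hx => ?_
      rw [div_mul_cancel₀]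
      exact (Real.sqrt_pos.mpr (hG00 x hx)).ne'
    rw [hdgam v hv] at e3
    rw [hc2 v hv] at e2
    have e4 : ∑ s, (∑ a, (g u)⁻¹ s a * c u a i j) * w u s l
        = (∑ s : Fin n, (∑ a, (g u)⁻¹ s a * c u a i j)
          * gam (Glow v) (C v) 0 s.succ l.succ) / Real.sqrt (G v 0 0) := by
      rw [hw', Finset.sum_div]
      refine Finset.sum_congr rfl fun s _ => ?_
      simp only [Matrix.of_apply, ← hvdef]
      rw [mul_div_assoc]
    rw [e4, hcontr i j (fun S => gam (Glow v) (C v) 0 S l.succ)]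
    simp only [hc1 v hv _ 0]
    rw [raise_gam (hGL v hv).1, e3]
    have e5 : C v 0 0 l.succ = Real.sqrt (G v 0 0)
        * pd l.succ (fun x => Real.sqrt (G x 0 0)) v := by linarith
    rw [e5]
    generalize pd l.succ (fun x => Real.sqrt (G x 0 0)) v = dr at *
    generalize pd l (fun x => w x i j) u = dw at *
    generalize gam (Glow v) (C v) 0 i.succ j.succ = W at *
    generalize Real.sqrt (G v 0 0) = r at *
    rw [← hrr]
    have := hr.ne'
    field_simp
    ring
  · intro m l p k
    have e1 : pd k (fun x => c x p m l) u
        = pd k.succ (fun x => low (Glow x) (C x) p.succ m.succ l.succ) v := by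
      rw [hc']; exact pd_cons (hlowd v hv _ _ _)
    have e2 : ∑ s, (∑ a, (g u)⁻¹ s a * c u a m l) * c u s p k
        = ∑ s : Fin n, (∑ a, (g u)⁻¹ s a * c u a m l)
          * low (Glow v) (C v) s.succ p.succ k.succ := by
      refine Finset.sum_congr rfl fun s _ => ?_
      congr 1
      rw [hc']
    have e3 : w u m l * w u p k = gam (Glow v) (C v) 0 m.succ l.succ
        * gam (Glow v) (C v) 0 p.succ k.succ / G v 0 0 := by
      rw [hw', ← hrr]
      simp only [Matrix.of_apply, ← hvdef]
      rw [div_mul_div_comm]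
    rw [e1, e2, e3, hcontr m l (fun S => low (Glow v) (C v) S p.succ k.succ)]
    simp only [hc1 v hv _ 0]
    rw [raise_low (hGL v hv).1]
    have := hdlow v hv k.succ p.succ m.succ l.succ
    rw [← this]
    ring
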